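/- arXiv:2203.00752 — 5 statements merged into one kernel-verified Lean document; each statement's English description precedes it below -/
import Mathlib

section
/- Let P ⊆ S be nonempty, x ∈ ℝ^n, θ ∈ ℝ^S, and let (λ^s)_{s∈P} be a family of vectors in ℝ^p satisfying conditions (9a)–(9b) at x. If for every s' ∈ P the aggregated optimality cut holds at λ^{s'}, i.e. p^P · (h^P − T^P x)·λ^{s'} ≤ Σ_{s∈P} p^s θ^s, then Σ_{s∈P} p^s (h^s − T^s x)·λ^s ≤ Σ_{s∈P} p^s θ^s. -/
open Finset Matrix BigOperators

/-- **Key step of Proposition 3.** If conditions (9a)–(9b) hold for a family of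
duals `(λˢ)_{s∈P}` at `x`, and the aggregated optimality cut holds at `λ^{s'}`
for every `s' ∈ P`, then `∑_{s∈P} pˢ (hˢ − Tˢ x)·λˢ ≤ ∑_{s∈P} pˢ θˢ`. -/
theorem disaggregated_bound_from_aggregated_cuts
    {n p : ℕ}
    {S : Type*} [Fintype S] (pr : S → ℝ) (hpr : ∀ s, 0 < pr s)
    (h : S → Fin p → ℝ) (T : S → Matrix (Fin p) (Fin n) ℝ)
    (P : Finset S) (hPne : P.Nonempty)
    (x : Fin n → ℝ) (θ : S → ℝ) (lam : S → Fin p → ℝ)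
    (h9a : (∑ s ∈ P, pr s) * ∑ s ∈ P, pr s * (h s ⬝ᵥ lam s)
      = (∑ s ∈ P, pr s • h s) ⬝ᵥ (∑ s ∈ P, pr s • lam s))
    (h9b : (∑ s ∈ P, pr s) * ∑ s ∈ P, pr s * (((T s).mulVec x) ⬝ᵥ lam s)
      = (∑ s ∈ P, pr s • (T s).mulVec x) ⬝ᵥ (∑ s ∈ P, pr s • lam s))
    (hcut : ∀ s' ∈ P,
      (∑ s ∈ P, pr s) *
        ((((∑ s ∈ P, pr s)⁻¹ • ∑ s ∈ P, pr s • h s)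
          - (((∑ s ∈ P, pr s)⁻¹ • ∑ s ∈ P, pr s • T s)).mulVec x) ⬝ᵥ lam s')
        ≤ ∑ s ∈ P, pr s * θ s) :
    ∑ s ∈ P, pr s * ((h s - (T s).mulVec x) ⬝ᵥ lam s) ≤ ∑ s ∈ P, pr s * θ s := by
  have hq : 0 < ∑ s ∈ P, pr s := Finset.sum_pos (fun s _ => hpr s) hPne
  have hT : (∑ s ∈ P, pr s • T s).mulVec x = ∑ s ∈ P, pr s • (T s).mulVec x := by
    rw [Matrix.sum_mulVec]
    exact Finset.sum_congr rfl fun s _ => Matrix.smul_mulVec _ _ _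
  have hcut' : ∀ s' ∈ P,
      (∑ s ∈ P, pr s • h s - ∑ s ∈ P, pr s • (T s).mulVec x) ⬝ᵥ lam s'
        ≤ ∑ s ∈ P, pr s * θ s := by
    intro s' hs'
    have h1 := hcut s' hs'
    rw [Matrix.smul_mulVec, hT, ← smul_sub, smul_dotProduct, smul_eq_mul,
      mul_inv_cancel_left₀ hq.ne'] at h1
    exact h1
  have hsum := Finset.sum_le_sum fun s hs =>
    mul_le_mul_of_nonneg_left (hcut' s hs) (hpr s).le
  rw [← Finset.sum_mul] at hsum
  have hL : ∑ s' ∈ P, pr s' *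
      ((∑ s ∈ P, pr s • h s - ∑ s ∈ P, pr s • (T s).mulVec x) ⬝ᵥ lam s')
      = (∑ s ∈ P, pr s) * ∑ s ∈ P, pr s * ((h s - (T s).mulVec x) ⬝ᵥ lam s) := by
    have h2 : ∑ s ∈ P, pr s * ((h s - (T s).mulVec x) ⬝ᵥ lam s)
        = ∑ s ∈ P, pr s * (h s ⬝ᵥ lam s)
          - ∑ s ∈ P, pr s * (((T s).mulVec x) ⬝ᵥ lam s) := by
      rw [← Finset.sum_sub_distrib]
      exact Finset.sum_congr rfl fun s _ => by rw [sub_dotProduct, mul_sub]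
    rw [h2, mul_sub, h9a, h9b, ← sub_dotProduct, dotProduct_sum]
    exact Finset.sum_congr rfl fun s _ => by rw [dotProduct_smul, smul_eq_mul]
  rw [hL] at hsum
  exact le_of_mul_le_mul_left hsum hq
end

section
/- Let X ⊆ ℝ^n, c ∈ ℝ^n, and let 𝒫 be a partition of S. Suppose (x*, θ*) with x* ∈ X minimizes the objective c·x + Σ_{s∈S} p^s θ^s over all pairs (x, θ) with x ∈ X satisfying (i) the aggregated optimality cuts p^P · (h^P − T^P x)·λ ≤ Σ_{s∈P} p^s θ^s for every P ∈ 𝒫 and every λ ∈ Λ, and (ii) the feasibility cuts (h^s − T^s x)·λ̃ ≤ 0 for every s ∈ S and every λ̃ ∈ Λ₀. Suppose moreover that for every s ∈ S there exist y^s ∈ ℝ^m with y^s ≥ 0 and W y^s = h^s − T^s x*, and λ^s ∈ Λ with q·y^s = (h^s − T^s x*)·λ^s, such that for every P ∈ 𝒫 the family (λ^s)_{s∈P} satisfies conditions (9a)–(9b) at x*. Then x* is optimal for the deterministic equivalent: for every x ∈ X and every family (z^s)_{s∈S} with z^s ≥ 0 and W z^s = h^s − T^s x, one has c·x* + Σ_{s∈S}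 p^s (q·y^s) ≤ c·x + Σ_{s∈S} p^s (q·z^s). -/
open Finset Matrix BigOperators

theorem cut_aux {n p : ℕ} {S : Type*} (P : Finset S) (pr : S → ℝ)
    (hP : (∑ s ∈ P, pr s) ≠ 0)
    (h : S → Fin p → ℝ) (T : S → Matrix (Fin p) (Fin n) ℝ) (x : Fin n → ℝ) (lam : Fin p → ℝ) :
    (∑ s ∈ P, pr s) *
        ((((∑ s ∈ P, pr s)⁻¹ • ∑ s ∈ P, pr s • h s)
          - (((∑ s ∈ P, pr s)⁻¹ • ∑ s ∈ P, pr s • T s)).mulVec x) ⬝ᵥ lam)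
      = (∑ s ∈ P, pr s • h s) ⬝ᵥ lam - (∑ s ∈ P, pr s • (T s).mulVec x) ⬝ᵥ lam := by
  have e : (∑ s ∈ P, pr s • T s).mulVec x = ∑ s ∈ P, pr s • (T s).mulVec x := by
    rw [Matrix.sum_mulVec]
    exact Finset.sum_congr rfl fun s _ => Matrix.smul_mulVec _ _ _
  rw [Matrix.smul_mulVec, e, ← smul_sub, smul_dotProduct, sub_dotProduct, smul_eq_mul,
    mul_inv_cancel_left₀ hP]

theorem weak_aux {m p : ℕ} (W : Matrix (Fin p) (Fin m) ℝ) (q z : Fin m → ℝ) (hz : 0 ≤ z)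
    (lam : Fin p → ℝ) (hl : W.transpose.mulVec lam ≤ q) : W.mulVec z ⬝ᵥ lam ≤ q ⬝ᵥ z := by
  have e : W.mulVec z ⬝ᵥ lam = W.transpose.mulVec lam ⬝ᵥ z := by
    rw [dotProduct_comm, dotProduct_mulVec, mulVec_transpose]
  rw [e]
  exact dotProduct_le_dotProduct_of_nonneg_right hl hz

/-- **Proposition 3.** If `(x*, θ*)` minimizes the adaptive-cuts master problem
(aggregated optimality cuts over a partition `parts` of `S`, plus feasibility cuts),
and at `x*` each scenario subproblem has a primal optimal `yˢ` with an LP-dual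
optimal `λˢ ∈ Λ` such that conditions (9a)–(9b) hold on each cell `P ∈ parts`, then
`x*` is optimal for the deterministic equivalent. -/
theorem benders_adaptive_cuts_optimal
    {n m p : ℕ} (W : Matrix (Fin p) (Fin m) ℝ) (q : Fin m → ℝ)
    {S : Type*} [Fintype S] [DecidableEq S]
    (pr : S → ℝ) (hpr : ∀ s, 0 < pr s)
    (h : S → Fin p → ℝ) (T : S → Matrix (Fin p) (Fin n) ℝ)
    (X : Set (Fin n → ℝ)) (c : Fin n → ℝ)
    (parts : Finset (Finset S))
    (hcellne : ∀ P ∈ parts, P.Nonempty)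
    (hdisj : ∀ P ∈ parts, ∀ Q ∈ parts, P ≠ Q → Disjoint P Q)
    (hcover : parts.biUnion id = Finset.univ)
    (xstar : Fin n → ℝ) (θstar : S → ℝ)
    (hxX : xstar ∈ X)
    -- (x*, θ*) satisfies the aggregated optimality cuts (i)
    (hfeasO : ∀ P ∈ parts, ∀ lam : Fin p → ℝ, W.transpose.mulVec lam ≤ q →
      (∑ s ∈ P, pr s) *
        ((((∑ s ∈ P, pr s)⁻¹ • ∑ s ∈ P, pr s • h s)
          - (((∑ s ∈ P, pr s)⁻¹ • ∑ s ∈ P, pr s • T s)).mulVec xstar) ⬝ᵥ lam)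
        ≤ ∑ s ∈ P, pr s * θstar s)
    -- (x*, θ*) satisfies the feasibility cuts (ii)
    (hfeasF : ∀ s : S, ∀ lam : Fin p → ℝ, W.transpose.mulVec lam ≤ 0 →
      (h s - (T s).mulVec xstar) ⬝ᵥ lam ≤ 0)
    -- (x*, θ*) minimizes the master objective over all feasible pairs
    (hmin : ∀ x ∈ X, ∀ θ : S → ℝ,
      (∀ P ∈ parts, ∀ lam : Fin p → ℝ, W.transpose.mulVec lam ≤ q →
        (∑ s ∈ P, pr s) *
          ((((∑ s ∈ P, pr s)⁻¹ • ∑ s ∈ P, pr s • h s)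
            - (((∑ s ∈ P, pr s)⁻¹ • ∑ s ∈ P, pr s • T s)).mulVec x) ⬝ᵥ lam)
          ≤ ∑ s ∈ P, pr s * θ s) →
      (∀ s : S, ∀ lam : Fin p → ℝ, W.transpose.mulVec lam ≤ 0 →
        (h s - (T s).mulVec x) ⬝ᵥ lam ≤ 0) →
      c ⬝ᵥ xstar + ∑ s, pr s * θstar s ≤ c ⬝ᵥ x + ∑ s, pr s * θ s)
    -- primal optimal yˢ and dual optimal λˢ at x*
    (y : S → Fin m → ℝ) (hy0 : ∀ s, 0 ≤ y s)
    (hyfeas : ∀ s, W.mulVec (y s) = h s - (T s).mulVec xstar)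
    (lam : S → Fin p → ℝ) (hlamfeas : ∀ s, W.transpose.mulVec (lam s) ≤ q)
    (hstrong : ∀ s, q ⬝ᵥ y s = (h s - (T s).mulVec xstar) ⬝ᵥ lam s)
    -- conditions (9a)–(9b) on each cell of the partition
    (hcond : ∀ P ∈ parts,
      (∑ s ∈ P, pr s) * ∑ s ∈ P, pr s * (h s ⬝ᵥ lam s)
        = (∑ s ∈ P, pr s • h s) ⬝ᵥ (∑ s ∈ P, pr s • lam s) ∧
      (∑ s ∈ P, pr s) * ∑ s ∈ P, pr s * (((T s).mulVec xstar) ⬝ᵥ lam s)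
        = (∑ s ∈ P, pr s • (T s).mulVec xstar) ⬝ᵥ (∑ s ∈ P, pr s • lam s)) :
    ∀ x ∈ X, ∀ z : S → Fin m → ℝ, (∀ s, 0 ≤ z s) →
      (∀ s, W.mulVec (z s) = h s - (T s).mulVec x) →
      c ⬝ᵥ xstar + ∑ s, pr s * (q ⬝ᵥ y s) ≤ c ⬝ᵥ x + ∑ s, pr s * (q ⬝ᵥ z s) := by
  intro x hx z hz hzf
  have hpos : ∀ P ∈ parts, 0 < ∑ s ∈ P, pr s := fun P hP =>
    Finset.sum_pos (fun s _ => hpr s) (hcellne P hP)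
  have hsplit : ∀ f : S → ℝ, ∑ s, f s = ∑ P ∈ parts, ∑ s ∈ P, f s := by
    intro f
    rw [← hcover, Finset.sum_biUnion]
    · rfl
    · intro P hP Q hQ hne
      exact hdisj P hP Q hQ hne
  have key := hmin x hx (fun s => q ⬝ᵥ z s) (by
    intro P hP l hl
    rw [cut_aux P pr (hpos P hP).ne', sum_dotProduct, sum_dotProduct, ← Finset.sum_sub_distrib]
    refine Finset.sum_le_sum fun s _ => ?_
    rw [smul_dotProduct, smul_dotProduct, ← smul_sub, ← sub_dotProduct, ← hzf s, smul_eq_mul]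
    exact mul_le_mul_of_nonneg_left (weak_aux W q (z s) (hz s) l hl) (hpr s).le) (by
    intro s l hl
    rw [← hzf s]
    simpa using weak_aux W 0 (z s) (hz s) l hl)
  have hle : ∑ s, pr s * (q ⬝ᵥ y s) ≤ ∑ s, pr s * θstar s := by
    rw [hsplit, hsplit]
    refine Finset.sum_le_sum fun P hP => ?_
    have hp := hpos P hP
    obtain ⟨ha, hb⟩ := hcond P hP
    have hfe : W.transpose.mulVec ((∑ s ∈ P, pr s)⁻¹ • ∑ s ∈ P, pr s • lam s) ≤ q := by
      rw [Matrix.mulVec_smul, Matrix.mulVec_sum]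
      intro i
      simp only [Matrix.mulVec_smul, Pi.smul_apply, Finset.sum_apply, smul_eq_mul]
      rw [inv_mul_le_iff₀ hp, Finset.sum_mul]
      exact Finset.sum_le_sum fun s _ => mul_le_mul_of_nonneg_left (hlamfeas s i) (hpr s).le
    have hc := hfeasO P hP _ hfe
    rw [cut_aux P pr hp.ne', dotProduct_smul, dotProduct_smul, ← ha, ← hb, smul_eq_mul,
      smul_eq_mul, inv_mul_cancel_left₀ hp.ne', inv_mul_cancel_left₀ hp.ne',
      ← Finset.sum_sub_distrib] at hc
    refine le_trans (le_of_eq ?_) hc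
    refine Finset.sum_congr rfl fun s _ => ?_
    rw [hstrong, sub_dotProduct, mul_sub]
  linarith
end

section
/- Let X ⊆ ℝ^n, c ∈ ℝ^n, and let 𝒫 be a partition of S. Suppose (x*, Θ*) with x* ∈ X minimizes the objective c·x + Θ over all pairs (x, Θ) with x ∈ X and Θ ∈ ℝ satisfying (i) the aggregated single optimality cuts Σ_{P∈𝒫} p^P · (h^P − T^P x)·λ_P ≤ Θ for every family (λ_P)_{P∈𝒫} with λ_P ∈ Λ, and (ii) the feasibility cuts (h^s − T^s x)·λ̃ ≤ 0 for every s ∈ S and every λ̃ ∈ Λ₀. Suppose moreover that for every s ∈ S there exist y^s ∈ ℝ^m with y^s ≥ 0 and W y^s = h^s − T^s x*, and λ^s ∈ Λ with q·y^s = (h^s − T^s x*)·λ^s, such that for every P ∈ 𝒫 the family (λ^s)_{s∈P} satisfies conditions (9a)–(9b) at x*. Then x* is optimal for the deterministic equivalent: for every x ∈ X and every family (z^s)_{s∈S} with z^s ≥ 0 and W z^s = h^s − T^s x, one has c·x* + Σ_{s∈S} p^s (q·y^s) ≤ c·x + Σ_{s∈S} p^s (q·z^s). -/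
open Finset Matrix BigOperators

theorem bend_agg {n p : ℕ} {S : Type*} (pr : S → ℝ) (h : S → Fin p → ℝ)
    (T : S → Matrix (Fin p) (Fin n) ℝ) (P : Finset S) (hP : (∑ s ∈ P, pr s) ≠ 0)
    (x : Fin n → ℝ) (l : Fin p → ℝ) :
    (∑ s ∈ P, pr s) *
        ((((∑ s ∈ P, pr s)⁻¹ • ∑ s ∈ P, pr s • h s)
          - (((∑ s ∈ P, pr s)⁻¹ • ∑ s ∈ P, pr s • T s)).mulVec x) ⬝ᵥ l)
      = ((∑ s ∈ P, pr s • h s) - ∑ s ∈ P, pr s • (T s).mulVec x) ⬝ᵥ l := by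
  have e : (∑ s ∈ P, pr s • T s).mulVec x = ∑ s ∈ P, pr s • (T s).mulVec x := by
    rw [Matrix.sum_mulVec]
    exact Finset.sum_congr rfl fun s _ => Matrix.smul_mulVec _ _ _
  rw [Matrix.smul_mulVec, e, ← smul_sub, smul_dotProduct, smul_eq_mul, mul_inv_cancel_left₀ hP]

theorem bend_agg2 {n p : ℕ} {S : Type*} (pr : S → ℝ) (h : S → Fin p → ℝ)
    (T : S → Matrix (Fin p) (Fin n) ℝ) (P : Finset S)
    (x : Fin n → ℝ) (l : Fin p → ℝ) :
    ((∑ s ∈ P, pr s • h s) - ∑ s ∈ P, pr s • (T s).mulVec x) ⬝ᵥ l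
      = ∑ s ∈ P, pr s * ((h s - (T s).mulVec x) ⬝ᵥ l) := by
  rw [← Finset.sum_sub_distrib, sum_dotProduct]
  exact Finset.sum_congr rfl fun s _ => by rw [← smul_sub, smul_dotProduct, smul_eq_mul]

theorem bend_weak {m p : ℕ} (W : Matrix (Fin p) (Fin m) ℝ) (q z : Fin m → ℝ)
    (l : Fin p → ℝ) (hl : W.transpose.mulVec l ≤ q) (hz : 0 ≤ z) :
    W.mulVec z ⬝ᵥ l ≤ q ⬝ᵥ z := by
  have e : W.mulVec z ⬝ᵥ l = W.transpose.mulVec l ⬝ᵥ z := by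
    rw [dotProduct_comm, dotProduct_mulVec, mulVec_transpose]
  rw [e]
  exact dotProduct_le_dotProduct_of_nonneg_right hl hz

/-- **Benders adaptive-single-cuts optimality (Section 3.3).** If `(x*, Θ*)`
minimizes the adaptive-single-cuts master problem (one aggregated cut per
family `(λ_P)_{P∈𝒫}` of duals, plus feasibility cuts), and at `x*` each
scenario subproblem has a primal optimal `yˢ` and LP-dual optimal `λˢ ∈ Λ`
satisfying (9a)–(9b) on each cell, then `x*` is optimal for the deterministic
equivalent. -/
theorem benders_adaptive_single_cuts_optimal
    {n m p : ℕ} (W : Matrix (Fin p) (Fin m) ℝ) (q : Fin m → ℝ)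
    {S : Type*} [Fintype S] [DecidableEq S]
    (pr : S → ℝ) (hpr : ∀ s, 0 < pr s)
    (h : S → Fin p → ℝ) (T : S → Matrix (Fin p) (Fin n) ℝ)
    (X : Set (Fin n → ℝ)) (c : Fin n → ℝ)
    (parts : Finset (Finset S))
    (hcellne : ∀ P ∈ parts, P.Nonempty)
    (hdisj : ∀ P ∈ parts, ∀ Q ∈ parts, P ≠ Q → Disjoint P Q)
    (hcover : parts.biUnion id = Finset.univ)
    (xstar : Fin n → ℝ) (Θstar : ℝ)
    (hxX : xstar ∈ X)
    -- (x*, Θ*) satisfies the aggregated single optimality cuts (i)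
    (hfeasO : ∀ lamF : Finset S → Fin p → ℝ,
      (∀ P ∈ parts, W.transpose.mulVec (lamF P) ≤ q) →
      (∑ P ∈ parts, (∑ s ∈ P, pr s) *
        ((((∑ s ∈ P, pr s)⁻¹ • ∑ s ∈ P, pr s • h s)
          - (((∑ s ∈ P, pr s)⁻¹ • ∑ s ∈ P, pr s • T s)).mulVec xstar) ⬝ᵥ lamF P))
        ≤ Θstar)
    -- (x*, Θ*) satisfies the feasibility cuts (ii)
    (hfeasF : ∀ s : S, ∀ lam : Fin p → ℝ, W.transpose.mulVec lam ≤ 0 →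
      (h s - (T s).mulVec xstar) ⬝ᵥ lam ≤ 0)
    -- (x*, Θ*) minimizes the master objective over all feasible pairs
    (hmin : ∀ x ∈ X, ∀ Θ : ℝ,
      (∀ lamF : Finset S → Fin p → ℝ,
        (∀ P ∈ parts, W.transpose.mulVec (lamF P) ≤ q) →
        (∑ P ∈ parts, (∑ s ∈ P, pr s) *
          ((((∑ s ∈ P, pr s)⁻¹ • ∑ s ∈ P, pr s • h s)
            - (((∑ s ∈ P, pr s)⁻¹ • ∑ s ∈ P, pr s • T s)).mulVec x) ⬝ᵥ lamF P))
          ≤ Θ) →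
      (∀ s : S, ∀ lam : Fin p → ℝ, W.transpose.mulVec lam ≤ 0 →
        (h s - (T s).mulVec x) ⬝ᵥ lam ≤ 0) →
      c ⬝ᵥ xstar + Θstar ≤ c ⬝ᵥ x + Θ)
    -- primal optimal yˢ and dual optimal λˢ at x*
    (y : S → Fin m → ℝ) (hy0 : ∀ s, 0 ≤ y s)
    (hyfeas : ∀ s, W.mulVec (y s) = h s - (T s).mulVec xstar)
    (lam : S → Fin p → ℝ) (hlamfeas : ∀ s, W.transpose.mulVec (lam s) ≤ q)
    (hstrong : ∀ s, q ⬝ᵥ y s = (h s - (T s).mulVec xstar) ⬝ᵥ lam s)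
    -- conditions (9a)–(9b) on each cell of the partition
    (hcond : ∀ P ∈ parts,
      (∑ s ∈ P, pr s) * ∑ s ∈ P, pr s * (h s ⬝ᵥ lam s)
        = (∑ s ∈ P, pr s • h s) ⬝ᵥ (∑ s ∈ P, pr s • lam s) ∧
      (∑ s ∈ P, pr s) * ∑ s ∈ P, pr s * (((T s).mulVec xstar) ⬝ᵥ lam s)
        = (∑ s ∈ P, pr s • (T s).mulVec xstar) ⬝ᵥ (∑ s ∈ P, pr s • lam s)) :
    ∀ x ∈ X, ∀ z : S → Fin m → ℝ, (∀ s, 0 ≤ z s) →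
      (∀ s, W.mulVec (z s) = h s - (T s).mulVec x) →
      c ⬝ᵥ xstar + ∑ s, pr s * (q ⬝ᵥ y s) ≤ c ⬝ᵥ x + ∑ s, pr s * (q ⬝ᵥ z s) := by
  intro x hx z hz0 hz
  have hpos : ∀ P ∈ parts, 0 < ∑ s ∈ P, pr s := fun P hP =>
    Finset.sum_pos (fun s _ => hpr s) (hcellne P hP)
  have hsum : ∀ f : S → ℝ, ∑ s, f s = ∑ P ∈ parts, ∑ s ∈ P, f s := by
    intro f
    rw [← hcover, Finset.sum_biUnion]
    · rfl
    · intro P hP Q hQ hPQ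
      exact hdisj P hP Q hQ hPQ
  have h1 : c ⬝ᵥ xstar + Θstar ≤ c ⬝ᵥ x + ∑ s, pr s * (q ⬝ᵥ z s) := by
    refine hmin x hx _ ?_ ?_
    · intro lamF hF
      rw [hsum]
      refine Finset.sum_le_sum fun P hP => ?_
      rw [bend_agg pr h T P (hpos P hP).ne', bend_agg2]
      refine Finset.sum_le_sum fun s _ => mul_le_mul_of_nonneg_left ?_ (hpr s).le
      rw [← hz s]
      exact bend_weak W q _ _ (hF P hP) (hz0 s)
    · intro s l hl
      rw [← hz s]
      simpa using bend_weak W 0 _ _ hl (hz0 s)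
  have h2 : ∑ s, pr s * (q ⬝ᵥ y s) ≤ Θstar := by
    refine le_trans (le_of_eq ?_)
      (hfeasO (fun P => (∑ s ∈ P, pr s)⁻¹ • ∑ s ∈ P, pr s • lam s) ?_)
    · rw [hsum]
      refine Finset.sum_congr rfl fun P hP => ?_
      obtain ⟨ha, hb⟩ := hcond P hP
      have h0 := (hpos P hP).ne'
      rw [bend_agg pr h T P h0, dotProduct_smul, sub_dotProduct, ← ha, ← hb, ← mul_sub,
        smul_eq_mul, inv_mul_cancel_left₀ h0, ← Finset.sum_sub_distrib]
      refine Finset.sum_congr rfl fun s _ => ?_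
      rw [hstrong s, sub_dotProduct, mul_sub]
    · intro P hP
      have h0 := hpos P hP
      intro j
      have e : (W.transpose.mulVec ((∑ s ∈ P, pr s)⁻¹ • ∑ s ∈ P, pr s • lam s)) j
          = (∑ s ∈ P, pr s)⁻¹ * ∑ s ∈ P, pr s * (W.transpose.mulVec (lam s)) j := by
        rw [Matrix.mulVec_smul, Matrix.mulVec_sum, Pi.smul_apply, Finset.sum_apply, smul_eq_mul]
        congr 1
        exact Finset.sum_congr rfl fun s _ => by
          rw [Matrix.mulVec_smul, Pi.smul_apply, smul_eq_mul]
      show (W.transpose.mulVec ((∑ s ∈ P, pr s)⁻¹ • ∑ s ∈ P, pr s • lam s)) j ≤ q j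
      rw [e, inv_mul_le_iff₀ h0, Finset.sum_mul]
      exact Finset.sum_le_sum fun s _ => mul_le_mul_of_nonneg_left (hlamfeas s j) (hpr s).le
  linarith
end

section
/- Let X ⊆ ℝ^n and c ∈ ℝ^n. For a partition 𝒫 of S, let F(𝒫) be the set of pairs (x, θ) with x ∈ X, θ ∈ ℝ^S, satisfying the aggregated optimality cuts p^P · (h^P − T^P x)·λ ≤ Σ_{s∈P} p^s θ^s for every P ∈ 𝒫 and every λ ∈ Λ, and the feasibility cuts (h^s − T^s x)·λ̃ ≤ 0 for every s ∈ S and every λ̃ ∈ Λ₀; let v(𝒫) := inf{ c·x + Σ_{s∈S} p^s θ^s : (x, θ) ∈ F(𝒫) }. Let 𝒫¹ and 𝒫² be partitions of S such that 𝒫² is a refinement of 𝒫¹ (every cell of 𝒫² is contained in some cell of 𝒫¹). If the set of objective values over F(𝒫¹) is bounded below and F(𝒫²) is nonempty, then v(𝒫¹) ≤ v(𝒫²). -/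
open Finset Matrix BigOperators

/-- Objective values of the adaptive-cuts master problem associated with a
partition `parts` of the scenario set. -/
def bendersMasterValues {n m p : ℕ} (W : Matrix (Fin p) (Fin m) ℝ) (q : Fin m → ℝ)
    {S : Type*} [Fintype S] (pr : S → ℝ)
    (h : S → Fin p → ℝ) (T : S → Matrix (Fin p) (Fin n) ℝ)
    (X : Set (Fin n → ℝ)) (c : Fin n → ℝ)
    (parts : Finset (Finset S)) : Set ℝ :=
  {v | ∃ x ∈ X, ∃ θ : S → ℝ,
    (∀ P ∈ parts, ∀ lam : Fin p → ℝ, W.transpose.mulVec lam ≤ q →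
      (∑ s ∈ P, pr s) *
        ((((∑ s ∈ P, pr s)⁻¹ • ∑ s ∈ P, pr s • h s)
          - (((∑ s ∈ P, pr s)⁻¹ • ∑ s ∈ P, pr s • T s)).mulVec x) ⬝ᵥ lam)
        ≤ ∑ s ∈ P, pr s * θ s) ∧
    (∀ s : S, ∀ lam : Fin p → ℝ, W.transpose.mulVec lam ≤ 0 →
      (h s - (T s).mulVec x) ⬝ᵥ lam ≤ 0) ∧
    v = c ⬝ᵥ x + ∑ s, pr s * θ s}

/-- The aggregated cut over a cell is the weighted sum of the scenario cuts. -/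
theorem benders_agg_eq {n p : ℕ} {S : Type*} (pr : S → ℝ) (hpr : ∀ s, 0 < pr s)
    (h : S → Fin p → ℝ) (T : S → Matrix (Fin p) (Fin n) ℝ) (x : Fin n → ℝ)
    (lam : Fin p → ℝ) (P : Finset S) (hP : P.Nonempty) :
    (∑ s ∈ P, pr s) *
        ((((∑ s ∈ P, pr s)⁻¹ • ∑ s ∈ P, pr s • h s)
          - (((∑ s ∈ P, pr s)⁻¹ • ∑ s ∈ P, pr s • T s)).mulVec x) ⬝ᵥ lam)
      = ∑ s ∈ P, pr s * ((h s - (T s).mulVec x) ⬝ᵥ lam) := by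
  have hpos : (∑ s ∈ P, pr s) ≠ 0 := (Finset.sum_pos (fun s _ => hpr s) hP).ne'
  rw [Matrix.smul_mulVec, ← smul_sub, smul_dotProduct, smul_eq_mul, mul_inv_cancel_left₀ hpos,
    Matrix.sum_mulVec, ← Finset.sum_sub_distrib, sum_dotProduct]
  refine Finset.sum_congr rfl fun s _ => ?_
  rw [Matrix.smul_mulVec, ← smul_sub, smul_dotProduct, smul_eq_mul]

/-- **Corollary 1.** If `parts₂` is a refinement of `parts₁`, the optimal value
of the adaptive-cuts master problem is monotone: `v(parts₁) ≤ v(parts₂)`. -/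
theorem benders_master_value_mono_of_refinement
    {n m p : ℕ} (W : Matrix (Fin p) (Fin m) ℝ) (q : Fin m → ℝ)
    {S : Type*} [Fintype S] [DecidableEq S]
    (pr : S → ℝ) (hpr : ∀ s, 0 < pr s)
    (h : S → Fin p → ℝ) (T : S → Matrix (Fin p) (Fin n) ℝ)
    (X : Set (Fin n → ℝ)) (c : Fin n → ℝ)
    (parts₁ parts₂ : Finset (Finset S))
    (h1ne : ∀ P ∈ parts₁, P.Nonempty)
    (h1disj : ∀ P ∈ parts₁, ∀ Q ∈ parts₁, P ≠ Q → Disjoint P Q)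
    (h1cover : parts₁.biUnion id = Finset.univ)
    (h2ne : ∀ P ∈ parts₂, P.Nonempty)
    (h2disj : ∀ P ∈ parts₂, ∀ Q ∈ parts₂, P ≠ Q → Disjoint P Q)
    (h2cover : parts₂.biUnion id = Finset.univ)
    (hrefine : ∀ P₂ ∈ parts₂, ∃ P₁ ∈ parts₁, P₂ ⊆ P₁)
    (hbdd : BddBelow (bendersMasterValues W q pr h T X c parts₁))
    (hne : (bendersMasterValues W q pr h T X c parts₂).Nonempty) :
    sInf (bendersMasterValues W q pr h T X c parts₁)
      ≤ sInf (bendersMasterValues W q pr h T X c parts₂) := by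
  refine csInf_le_csInf hbdd hne ?_
  rintro v ⟨x, hx, θ, hopt, hfeas, hv⟩
  refine ⟨x, hx, θ, ?_, hfeas, hv⟩
  intro P hP lam hlam
  rw [benders_agg_eq pr hpr h T x lam P (h1ne P hP)]
  have hPU : P = (parts₂.filter (fun Q => Q ⊆ P)).biUnion id := by
    ext s
    simp only [Finset.mem_biUnion, Finset.mem_filter, id]
    constructor
    · intro hs
      have hs2 : s ∈ parts₂.biUnion id := by rw [h2cover]; exact Finset.mem_univ s
      obtain ⟨Q, hQ, hsQ⟩ := Finset.mem_biUnion.mp hs2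
      obtain ⟨P', hP', hQP'⟩ := hrefine Q hQ
      have hPP : P' = P := by
        by_contra hne'
        exact (Finset.disjoint_left.mp (h1disj P' hP' P hP hne') (hQP' hsQ)) hs
      exact ⟨Q, ⟨hQ, hPP ▸ hQP'⟩, hsQ⟩
    · rintro ⟨Q, ⟨_, hQP⟩, hsQ⟩
      exact hQP hsQ
  have hd : Set.PairwiseDisjoint (↑(parts₂.filter (fun Q => Q ⊆ P)) : Set (Finset S)) id := by
    intro A hA B hB hAB
    exact h2disj A (Finset.mem_filter.mp hA).1 B (Finset.mem_filter.mp hB).1 hAB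
  rw [hPU, Finset.sum_biUnion hd, Finset.sum_biUnion hd]
  refine Finset.sum_le_sum fun Q hQ => ?_
  have hQ2 := (Finset.mem_filter.mp hQ).1
  have := hopt Q hQ2 lam hlam
  rwa [benders_agg_eq pr hpr h T x lam Q (h2ne Q hQ2)] at this
end

section
/- Fix x̄ ∈ ℝ^n and a nonempty finite set P of scenarios with weights w_s > 0 (s ∈ P) summing to 1. Suppose for each s ∈ P there are y^s ∈ ℝ^m with y^s ≥ 0 and W y^s = h^s − T^s x̄, and λ^s ∈ Λ with q·y^s = (h^s − T^s x̄)·λ^s (so y^s is primal optimal and λ^s is LP-dual optimal for the subproblem of scenario s). If (6a): (Σ_{s∈P} w_s h^s)·(Σ_{s∈P} w_s λ^s) = Σ_{s∈P} w_s (h^s·λ^s) and (6b): (Σ_{s∈P} w_s T^s x̄)·(Σ_{s∈P} w_s λ^s) = Σ_{s∈P} w_s ((T^s x̄)·λ^s) hold, then the aggregated subproblem attains its minimum and Q(x̄, Σ_{s∈P} w_s h^s, Σ_{s∈P} w_s T^s) = Σ_{s∈P} w_s Q(x̄, h^s, T^s) = Σ_{s∈P} w_s (q·y^s). -/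
open Finset Matrix BigOperators

/-- Second-stage value `Q(x, h, T) = inf {q·y : y ≥ 0, W y = h − T x}`. -/
noncomputable def secondStageValue {n m p : ℕ}
    (W : Matrix (Fin p) (Fin m) ℝ) (q : Fin m → ℝ)
    (x : Fin n → ℝ) (h : Fin p → ℝ) (T : Matrix (Fin p) (Fin n) ℝ) : ℝ :=
  sInf {v | ∃ y : Fin m → ℝ, 0 ≤ y ∧ W.mulVec y = h - T.mulVec x ∧ v = q ⬝ᵥ y}

theorem secondStageValue_eq_of_strong {n m p : ℕ}
    (W : Matrix (Fin p) (Fin m) ℝ) (q : Fin m → ℝ)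
    (x : Fin n → ℝ) (h : Fin p → ℝ) (T : Matrix (Fin p) (Fin n) ℝ)
    (y : Fin m → ℝ) (hy0 : 0 ≤ y) (hy : W.mulVec y = h - T.mulVec x)
    (l : Fin p → ℝ) (hl : W.transpose.mulVec l ≤ q)
    (hs : q ⬝ᵥ y = (h - T.mulVec x) ⬝ᵥ l) :
    secondStageValue W q x h T = q ⬝ᵥ y := by
  unfold secondStageValue
  apply IsLeast.csInf_eq
  refine ⟨⟨y, hy0, hy, rfl⟩, ?_⟩
  rintro v ⟨z, hz0, hz, rfl⟩
  rw [hs, ← hz, dotProduct_comm, dotProduct_mulVec, ← mulVec_transpose]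
  exact dotProduct_le_dotProduct_of_nonneg_right hl hz0

/-- **Proposition 1 (GAPM).** Suppose each scenario subproblem at `x̄` has a
primal optimal solution `yˢ` (certified by an LP-dual optimal `λˢ ∈ Λ` via
strong duality). If conditions (6a)–(6b) hold, then the aggregated subproblem
attains its minimum and
`Q(x̄, ∑ wˢ hˢ, ∑ wˢ Tˢ) = ∑ wˢ Q(x̄, hˢ, Tˢ) = ∑ wˢ (q·yˢ)`. -/
theorem gapm_aggregated_subproblem_eq
    {n m p : ℕ} (W : Matrix (Fin p) (Fin m) ℝ) (q : Fin m → ℝ)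
    (xbar : Fin n → ℝ)
    {P : Type*} [Fintype P] [Nonempty P]
    (w : P → ℝ) (hw : ∀ s, 0 < w s) (hw1 : ∑ s, w s = 1)
    (h : P → Fin p → ℝ) (T : P → Matrix (Fin p) (Fin n) ℝ)
    (y : P → Fin m → ℝ) (hy0 : ∀ s, 0 ≤ y s)
    (hyfeas : ∀ s, W.mulVec (y s) = h s - (T s).mulVec xbar)
    (lam : P → Fin p → ℝ) (hlam : ∀ s, W.transpose.mulVec (lam s) ≤ q)
    (hstrong : ∀ s, q ⬝ᵥ y s = (h s - (T s).mulVec xbar) ⬝ᵥ lam s)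
    (h6a : (∑ s, w s • h s) ⬝ᵥ (∑ s, w s • lam s) = ∑ s, w s * (h s ⬝ᵥ lam s))
    (h6b : (∑ s, w s • (T s).mulVec xbar) ⬝ᵥ (∑ s, w s • lam s)
        = ∑ s, w s * (((T s).mulVec xbar) ⬝ᵥ lam s)) :
    (∃ ybar : Fin m → ℝ, 0 ≤ ybar ∧
        W.mulVec ybar = (∑ s, w s • h s) - (∑ s, w s • T s).mulVec xbar ∧
        q ⬝ᵥ ybar = secondStageValue W q xbar (∑ s, w s • h s) (∑ s, w s • T s)) ∧
    secondStageValue W q xbar (∑ s, w s • h s) (∑ s, w s • T s)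
        = ∑ s, w s * secondStageValue W q xbar (h s) (T s) ∧
    ∑ s, w s * secondStageValue W q xbar (h s) (T s) = ∑ s, w s * (q ⬝ᵥ y s) := by
  have hT : (∑ s, w s • T s).mulVec xbar = ∑ s, w s • (T s).mulVec xbar := by
    rw [Matrix.sum_mulVec]
    simp only [smul_mulVec]
  have hQ : ∀ s, secondStageValue W q xbar (h s) (T s) = q ⬝ᵥ y s := fun s =>
    secondStageValue_eq_of_strong W q xbar (h s) (T s) (y s) (hy0 s) (hyfeas s)
      (lam s) (hlam s) (hstrong s)
  have hqy : q ⬝ᵥ (∑ s, w s • y s) = ∑ s, w s * (q ⬝ᵥ y s) := by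
    simp only [dotProduct_sum, dotProduct_smul, smul_eq_mul]
  have h0 : (0 : Fin m → ℝ) ≤ ∑ s, w s • y s :=
    Finset.sum_nonneg fun s _ => smul_nonneg (hw s).le (hy0 s)
  have hf : W.mulVec (∑ s, w s • y s)
      = (∑ s, w s • h s) - (∑ s, w s • T s).mulVec xbar := by
    rw [hT, Matrix.mulVec_sum, ← Finset.sum_sub_distrib]
    simp only [mulVec_smul, hyfeas, smul_sub]
  have hl : W.transpose.mulVec (∑ s, w s • lam s) ≤ q := by
    rw [Matrix.mulVec_sum]
    calc ∑ s, W.transpose.mulVec (w s • lam s) ≤ ∑ s, w s • q := by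
          refine Finset.sum_le_sum fun s _ => ?_
          rw [mulVec_smul]
          exact smul_le_smul_of_nonneg_left (hlam s) (hw s).le
      _ = q := by rw [← Finset.sum_smul, hw1, one_smul]
  have hst : q ⬝ᵥ (∑ s, w s • y s)
      = ((∑ s, w s • h s) - (∑ s, w s • T s).mulVec xbar) ⬝ᵥ (∑ s, w s • lam s) := by
    rw [hqy, hT, sub_dotProduct, h6a, h6b, ← Finset.sum_sub_distrib]
    simp only [hstrong, sub_dotProduct, mul_sub]
  have hagg := secondStageValue_eq_of_strong W q xbar _ _ _ h0 hf _ hl hst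
  refine ⟨⟨_, h0, hf, hagg.symm⟩, ?_, ?_⟩
  · simp only [hagg, hqy, hQ]
  · simp only [hQ]
end
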